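/- Let W be a C¹ solution on [1, +∞) of dW/dr = (g(W) − W)/r with W(1) = α and W taking values in (γ₀, +∞). If α > c_*, then W(r) > c_* and W′(r) < 0 for all r ≥ 1; if γ₀ < α < c_*, then W(r) < c_* and W′(r) > 0 for all r ≥ 1; if α = c_*, then W(r) = c_* for all r ≥ 1. -/

import Mathlib

open Set Filter

/-- The vector `(β, γ, …, γ) ∈ ℝⁿ`: first coordinate `β`, all remaining coordinates `γ`. -/
def vec (n : ℕ) (β γ : ℝ) : Fin n → ℝ := fun j => if (j : ℕ) = 0 then β else γ

/-- `w` is a `C¹` solution on `[1, ∞)` of the ODE `dW/dr = (g(W) - W)/r` with `w 1 = a`,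
taking values in `(γ₀, ∞)`. -/
def IsSolW (g : ℝ → ℝ) (γ₀ a : ℝ) (w : ℝ → ℝ) : Prop :=
  ContDiffOn ℝ 1 w (Set.Ici 1) ∧ w 1 = a ∧ (∀ r ∈ Set.Ici (1 : ℝ), γ₀ < w r) ∧
    ∀ r ∈ Set.Ici (1 : ℝ), HasDerivWithinAt w ((g (w r) - w r) / r) (Set.Ici 1) r

/-- A function with positive partial derivatives on a convex open set is strictly increasing there
for the product order. -/
theorem lt_of_lt_of_fderiv_single_pos {ι : Type*} [Fintype ι] [DecidableEq ι] {s : Set (ι → ℝ)}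
    (hso : IsOpen s) (hsc : Convex ℝ s) {f : (ι → ℝ) → ℝ} (hf : DifferentiableOn ℝ f s)
    (hpos : ∀ x ∈ s, ∀ j, 0 < fderiv ℝ f x (Pi.single j 1)) {x y : ι → ℝ} (hx : x ∈ s)
    (hy : y ∈ s) (hxy : x < y) : f x < f y := by
  obtain ⟨z, hz, h⟩ := domain_mvt (f' := fderiv ℝ f)
    (fun p hp => ((hf p hp).differentiableAt (hso.mem_nhds hp)).hasFDerivAt.hasFDerivWithinAt)
    hsc hx hy
  have hzs := hsc.segment_subset hx hy hz
  obtain ⟨hle, j, hj⟩ := Pi.lt_def.1 hxy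
  have hsingle (i : ι) : (fun k => if i = k then (1 : ℝ) else 0) = Pi.single i 1 := by
    ext k
    simp [Pi.single_apply, eq_comm]
  rw [← ContinuousLinearMap.coe_coe, LinearMap.pi_apply_eq_sum_univ] at h
  simp only [hsingle, ContinuousLinearMap.coe_coe, smul_eq_mul, Pi.sub_apply] at h
  rw [← sub_pos, h]
  exact Finset.sum_pos' (fun i _ => mul_nonneg (sub_nonneg.2 (hle i)) (hpos z hzs i).le)
    ⟨j, Finset.mem_univ j, mul_pos (sub_pos.2 hj) (hpos z hzs j)⟩

theorem vec_self (n : ℕ) (c : ℝ) : vec n c c = fun _ => c := by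
  ext j
  simp [vec]

theorem vec_combo (n : ℕ) (a b β₁ γ₁ β₂ γ₂ : ℝ) :
    a • vec n β₁ γ₁ + b • vec n β₂ γ₂ = vec n (a * β₁ + b * β₂) (a * γ₁ + b * γ₂) := by
  ext j
  by_cases hj : (j : ℕ) = 0 <;> simp [vec, hj]

theorem vec_lt_vec_left {n : ℕ} (hn : 1 ≤ n) {β₁ β₂ : ℝ} (γ : ℝ) (hβ : β₁ < β₂) :
    vec n β₁ γ < vec n β₂ γ := by
  refine Pi.lt_def.2 ⟨fun j => ?_, ⟨0, hn⟩, by simpa [vec] using hβ⟩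
  by_cases hj : (j : ℕ) = 0 <;> simp [vec, hj, hβ.le]

theorem vec_lt_vec_right {n : ℕ} (hn : 2 ≤ n) {β₁ β₂ γ₁ γ₂ : ℝ} (hβ : β₁ ≤ β₂) (hγ : γ₁ < γ₂) :
    vec n β₁ γ₁ < vec n β₂ γ₂ := by
  refine Pi.lt_def.2 ⟨fun j => ?_, ⟨1, hn⟩, by simpa [vec] using hγ⟩
  by_cases hj : (j : ℕ) = 0 <;> simp [vec, hj, hβ, hγ.le]

/-- The function `g` whose graph is the level set `f (vec n β γ) = 1` of a concave function
increasing in each variable is convex. -/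
theorem convexOn_of_level {n : ℕ} (hn : 1 ≤ n) {Γ : Set (Fin n → ℝ)} {f : (Fin n → ℝ) → ℝ}
    (hf : ConcaveOn ℝ Γ f) (hmono : ∀ x ∈ Γ, ∀ y ∈ Γ, x < y → f x < f y) {γ₀ : ℝ} {g : ℝ → ℝ}
    (hg : ∀ γ ∈ Ioi γ₀, vec n (g γ) γ ∈ Γ ∧ f (vec n (g γ) γ) = 1) :
    ConvexOn ℝ (Ioi γ₀) g := by
  refine ⟨convex_Ioi γ₀, fun x hx y hy a b ha hb hab => ?_⟩
  have hz := hg _ (convex_Ioi γ₀ hx hy ha hb hab)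
  have hmem := hf.1 (hg x hx).1 (hg y hy).1 ha hb hab
  have hval := hf.2 (hg x hx).1 (hg y hy).1 ha hb hab
  rw [vec_combo] at hmem hval
  rw [(hg x hx).2, (hg y hy).2, smul_eq_mul, smul_eq_mul, mul_one, mul_one, hab] at hval
  by_contra! hlt
  have := hmono _ hmem _ hz.1 (vec_lt_vec_left hn _ hlt)
  simp only [smul_eq_mul] at hz this
  linarith [hz.2]

/-- A convex function with fixed point `c` which lies above `c` at `γ₁ < c` satisfies a
one-sided Lipschitz bound at `c`. -/
theorem ConvexOn.exists_mul_sub_ge {s : Set ℝ} {g : ℝ → ℝ} (hg : ConvexOn ℝ s g) {γ₁ c : ℝ}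
    (h₁ : γ₁ ∈ s) (hc : c ∈ s) (hlt : γ₁ < c) (hgc : g c = c) (hg₁ : c ≤ g γ₁) :
    ∃ K, 0 ≤ K ∧ ∀ x ∈ s, γ₁ ≤ x → -K * (x - c) ^ 2 ≤ (x - c) * (g x - x) := by
  set S := (g γ₁ - c) / (c - γ₁) with hS
  have hS0 : 0 ≤ S := div_nonneg (by linarith) (by linarith)
  have hSmul : S * (c - γ₁) = g γ₁ - c := div_mul_cancel₀ _ (by linarith)
  refine ⟨S + 1, by linarith, fun x hx h₁x => ?_⟩
  suffices h : 0 ≤ (x - c) * (g x - c + S * (x - c)) by nlinarith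
  rcases lt_trichotomy x c with hxc | rfl | hxc
  · rcases h₁x.eq_or_lt with rfl | h₁x
    · rw [show g γ₁ - c + S * (γ₁ - c) = 0 by linarith, mul_zero]
    · have := hg.secant_mono_aux1 h₁ hc h₁x hxc
      rw [hgc] at this
      refine mul_nonneg_of_nonpos_of_nonpos (by linarith) ?_
      have h2 : (c - γ₁) * (g x - c + S * (x - c)) ≤ 0 := by
        have : (c - γ₁) * (S * (x - c)) = (g γ₁ - c) * (x - c) := by rw [← hSmul]; ring
        nlinarith
      exact nonpos_of_mul_nonpos_right h2 (by linarith)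
  · simp
  · have := hg.secant_mono_aux1 h₁ hx hlt hxc
    rw [hgc] at this
    refine mul_nonneg (by linarith) ?_
    have h2 : 0 ≤ (c - γ₁) * (g x - c + S * (x - c)) := by
      have : (c - γ₁) * (S * (x - c)) = (g γ₁ - c) * (x - c) := by rw [← hSmul]; ring
      nlinarith
    exact nonneg_of_mul_nonneg_right h2 (by linarith)

/-- Solutions of `w' = (g w - w) / r` starting away from `c` do not reach `c` as long as
`g` satisfies a one-sided Lipschitz bound at `c` along the solution. -/
theorem ne_of_mul_sub_ge {g w : ℝ → ℝ} {c K R : ℝ} (hK : 0 ≤ K) (hR : 1 ≤ R)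
    (hw : ∀ r ∈ Ici (1 : ℝ), HasDerivWithinAt w ((g (w r) - w r) / r) (Ici 1) r)
    (hb : ∀ r ∈ Icc 1 R, -K * (w r - c) ^ 2 ≤ (w r - c) * (g (w r) - w r)) (h1 : w 1 ≠ c) :
    w R ≠ c := by
  have hcont : ContinuousOn w (Icc 1 R) := fun r hr =>
    (hw r hr.1).continuousWithinAt.mono Icc_subset_Ici_self
  have hmono : MonotoneOn (fun r => (w r - c) ^ 2 * Real.exp (2 * K * r)) (Icc 1 R) := by
    refine monotoneOn_of_hasDerivWithinAt_nonneg (convex_Icc 1 R) (by fun_prop)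
      (f' := fun r => (2 * (w r - c) * ((g (w r) - w r) / r) + 2 * K * (w r - c) ^ 2)
        * Real.exp (2 * K * r)) (fun r hr => ?_) (fun r hr => ?_)
    · rw [interior_Icc] at hr ⊢
      have hd := (hw r hr.1.le).mono (Ioo_subset_Icc_self.trans Icc_subset_Ici_self : Ioo 1 R ⊆ _)
      have he : HasDerivWithinAt (fun r => Real.exp (2 * K * r))
          (Real.exp (2 * K * r) * (2 * K * 1)) (Ioo 1 R) r :=
        (((hasDerivAt_id r).const_mul (2 * K)).exp).hasDerivWithinAt
      refine (((hd.sub_const c).pow 2).mul he).congr_deriv ?_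
      simp
      ring
    · rw [interior_Icc] at hr
      refine mul_nonneg ?_ (Real.exp_pos _).le
      have hr0 : 0 < r := by linarith [hr.1]
      have h2 := hb r (Ioo_subset_Icc_self hr)
      have h3 : -K * (w r - c) ^ 2 ≤ (w r - c) * (g (w r) - w r) / r := by
        rw [le_div_iff₀ hr0]
        have : 0 ≤ K * (w r - c) ^ 2 * (r - 1) :=
          mul_nonneg (by positivity) (by linarith [hr.1])
        nlinarith
      have h4 : 2 * (w r - c) * ((g (w r) - w r) / r)
          = 2 * ((w r - c) * (g (w r) - w r) / r) := by ring
      rw [h4]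
      linarith
  intro hRc
  have hle := hmono (left_mem_Icc.2 hR) (right_mem_Icc.2 hR) hR
  have : 0 < (w 1 - c) ^ 2 := by have := sub_ne_zero.2 h1; positivity
  have := mul_pos this (Real.exp_pos (2 * K * 1))
  simp only [hRc, sub_self] at hle
  norm_num at hle this
  linarith

/-- A solution of `w' = (g w - w) / r` starting at `c` stays there if `g w - w` points
towards `c` along the solution. -/
theorem eq_of_mul_sub_nonpos {g w : ℝ → ℝ} {c : ℝ}
    (hw : ∀ r ∈ Ici (1 : ℝ), HasDerivWithinAt w ((g (w r) - w r) / r) (Ici 1) r)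
    (hb : ∀ r ∈ Ici (1 : ℝ), (w r - c) * (g (w r) - w r) ≤ 0) (h1 : w 1 = c) :
    ∀ r ∈ Ici (1 : ℝ), w r = c := by
  have hcont : ContinuousOn w (Ici 1) := fun r hr => (hw r hr).continuousWithinAt
  have hanti : AntitoneOn (fun r => (w r - c) ^ 2) (Ici 1) := by
    refine antitoneOn_of_hasDerivWithinAt_nonpos (convex_Ici 1) (by fun_prop)
      (f' := fun r => 2 * ((w r - c) * (g (w r) - w r) / r)) (fun r hr => ?_) (fun r hr => ?_)
    · have hd := (hw r (interior_subset hr)).mono interior_subset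
      refine ((hd.sub_const c).pow 2).congr_deriv ?_
      simp
      ring
    · have hr1 : 1 ≤ r := interior_subset hr
      have := div_nonpos_of_nonpos_of_nonneg (hb r hr1) (by linarith : 0 ≤ r)
      linarith
  intro r hr
  have hle := hanti self_mem_Ici hr hr
  simp only [h1, sub_self] at hle
  have : (w r - c) ^ 2 = 0 := le_antisymm (by simpa using hle) (sq_nonneg _)
  exact sub_eq_zero.1 (pow_eq_zero_iff two_ne_zero |>.1 this)

/-- If `α > c_*` then `W > c_*` and `W′ < 0` on `[1, ∞)`; if `γ₀ < α < c_*` then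
`W < c_*` and `W′ > 0` on `[1, ∞)`; if `α = c_*` then `W ≡ c_*` on `[1, ∞)`. -/
theorem stmt10 (n : ℕ) (hn : 2 ≤ n)
    (Γ : Set (Fin n → ℝ))
    (hΓopen : IsOpen Γ)
    (hΓconv : Convex ℝ Γ)
    (hΓcone : ∀ x ∈ Γ, ∀ t : ℝ, 0 < t → t • x ∈ Γ)
    (hΓsym : ∀ σ : Equiv.Perm (Fin n), ∀ x ∈ Γ, (x ∘ σ) ∈ Γ)
    (hΓ1 : {x : Fin n → ℝ | ∀ j, 0 < x j} ⊆ Γ)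
    (hΓ2 : Γ ⊆ {x : Fin n → ℝ | 0 < ∑ j, x j})
    (f : (Fin n → ℝ) → ℝ)
    (hfsmooth : ContDiffOn ℝ (⊤ : ℕ∞) f Γ)
    (hfcont : ContinuousOn f (closure Γ))
    (hfsym : ∀ σ : Equiv.Perm (Fin n), ∀ x : Fin n → ℝ, f (x ∘ σ) = f x)
    (hfconc : ConcaveOn ℝ Γ f)
    (hfpos : ∀ x ∈ Γ, 0 < f x)
    (hfbd : ∀ x ∈ frontier Γ, f x = 0)
    (hfmono : ∀ x ∈ Γ, ∀ j : Fin n, 0 < fderiv ℝ f x (Pi.single j 1))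
    (cstar : ℝ) (hcstar : 0 < cstar)
    (hfcstar : f (fun _ => cstar) = 1)
    (γ₀ : ℝ)
    (hγ₀ : γ₀ = sInf {γ : ℝ | 0 < γ ∧ ∃ β : ℝ, vec n β γ ∈ Γ ∧ f (vec n β γ) = 1})
    (hγ₀0 : 0 ≤ γ₀) (hγ₀cstar : γ₀ < cstar)
    (g : ℝ → ℝ)
    (hg : ∀ γ ∈ Set.Ioi γ₀, vec n (g γ) γ ∈ Γ ∧ f (vec n (g γ) γ) = 1)
    (hgu : ∀ γ ∈ Set.Ioi γ₀, ∀ β : ℝ, vec n β γ ∈ Γ → f (vec n β γ) = 1 → β = g γ)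
    (α : ℝ) (w : ℝ → ℝ) (hw : IsSolW g γ₀ α w) :
    (cstar < α → ∀ r ∈ Set.Ici (1 : ℝ),
        cstar < w r ∧ derivWithin w (Set.Ici 1) r < 0) ∧
    (γ₀ < α → α < cstar → ∀ r ∈ Set.Ici (1 : ℝ),
        w r < cstar ∧ 0 < derivWithin w (Set.Ici 1) r) ∧
    (α = cstar → ∀ r ∈ Set.Ici (1 : ℝ), w r = cstar) := by
  obtain ⟨-, hw1, hwγ, hwd⟩ := hw
  have hmono : ∀ x ∈ Γ, ∀ y ∈ Γ, x < y → f x < f y := fun x hx y hy hxy =>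
    lt_of_lt_of_fderiv_single_pos hΓopen hΓconv (hfsmooth.differentiableOn (by simp)) hfmono
      hx hy hxy
  have hconv := convexOn_of_level (by omega) hfconc hmono hg
  have hcΓ : vec n cstar cstar ∈ Γ := by
    rw [vec_self]
    exact hΓ1 fun _ => hcstar
  have hfc : f (vec n cstar cstar) = 1 := by rw [vec_self, hfcstar]
  have hgc : g cstar = cstar := (hgu cstar hγ₀cstar cstar hcΓ hfc).symm
  have hgt : ∀ γ, cstar < γ → g γ < cstar := by
    intro γ hγ
    by_contra! hle
    have h := hg γ (hγ₀cstar.trans hγ)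
    linarith [hmono _ hcΓ _ h.1 (vec_lt_vec_right hn hle hγ), h.2]
  have hlt : ∀ γ, γ₀ < γ → γ < cstar → cstar < g γ := by
    intro γ hγ₀γ hγ
    by_contra! hle
    have h := hg γ hγ₀γ
    linarith [hmono _ h.1 _ hcΓ (vec_lt_vec_right hn hle hγ), h.2]
  have hcont : ContinuousOn w (Ici 1) := fun r hr => (hwd r hr).continuousWithinAt
  have hne : α ≠ cstar → ∀ r ∈ Ici (1 : ℝ), w r ≠ cstar := by
    intro hα R hR
    obtain ⟨m, hm, hmin⟩ := isCompact_Icc.exists_isMinOn (nonempty_Icc.2 hR)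
      (hcont.mono Icc_subset_Ici_self)
    obtain ⟨γ₁, hγ₁, hγ₁lt⟩ := exists_between (lt_min (hwγ m hm.1) hγ₀cstar)
    have hγ₁c : γ₁ < cstar := hγ₁lt.trans_le (min_le_right _ _)
    obtain ⟨K, hK, hKb⟩ := hconv.exists_mul_sub_ge hγ₁ hγ₀cstar hγ₁c hgc (hlt γ₁ hγ₁ hγ₁c).le
    exact ne_of_mul_sub_ge hK hR hwd (fun r hr => hKb _ (hwγ r hr.1)
      ((hγ₁lt.trans_le (min_le_left _ _)).le.trans (hmin hr))) (hw1 ▸ hα)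
  have hderiv : ∀ r ∈ Ici (1 : ℝ), derivWithin w (Ici 1) r = (g (w r) - w r) / r :=
    fun r hr => (hwd r hr).derivWithin (uniqueDiffOn_Ici 1 r hr)
  have hsub : ∀ r : ℝ, Icc 1 r ⊆ Ici 1 := fun r => Icc_subset_Ici_self
  refine ⟨fun hα r hr => ?_, fun _ hα r hr => ?_, fun hα => ?_⟩
  · have hwr : cstar < w r := by
      by_contra! hle
      obtain ⟨s, hs, hsc⟩ := intermediate_value_Icc' hr (hcont.mono (hsub r))
        ⟨hle, hw1.symm ▸ hα.le⟩
      exact hne hα.ne' s hs.1 hsc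
    refine ⟨hwr, ?_⟩
    rw [hderiv r hr]
    exact div_neg_of_neg_of_pos (by linarith [hgt _ hwr]) (zero_lt_one.trans_le hr)
  · have hwr : w r < cstar := by
      by_contra! hle
      obtain ⟨s, hs, hsc⟩ := intermediate_value_Icc hr (hcont.mono (hsub r))
        ⟨hw1.symm ▸ hα.le, hle⟩
      exact hne hα.ne s hs.1 hsc
    refine ⟨hwr, ?_⟩
    rw [hderiv r hr]
    exact div_pos (by linarith [hlt _ (hwγ r hr) hwr]) (zero_lt_one.trans_le hr)
  · refine eq_of_mul_sub_nonpos hwd (fun r hr => ?_) (hw1.trans hα)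
    rcases lt_trichotomy (w r) cstar with h | h | h
    · exact mul_nonpos_of_nonpos_of_nonneg (by linarith) (by linarith [hlt _ (hwγ r hr) h])
    · simp [h]
    · exact mul_nonpos_of_nonneg_of_nonpos (by linarith) (by linarith [hgt _ h])
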